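/- Let n = 2m be even and let Q be the standard quadratic form Q(x) = x₁² + ⋯ + x_n² on ℂⁿ. Then the Clifford algebra of Q over ℂ is isomorphic, as a ℂ-algebra, to the full matrix algebra of complex 2^m × 2^m matrices. -/

import Mathlib

/-- If the linear map `f : V → Mₙ(R)` squares to a quadratic form `q`, then this map squares to the
orthogonal sum of `q` and the hyperbolic form `(s, t) ↦ s * t`. -/
def hyperbolicBlocks {R V n : Type*} [CommRing R] [AddCommGroup V] [Module R V]
    [Fintype n] [DecidableEq n] (f : V →ₗ[R] Matrix n n R) :
    V × R × R →ₗ[R] Matrix (n ⊕ n) (n ⊕ n) R where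
  toFun p := Matrix.fromBlocks (f p.1) (p.2.1 • 1) (p.2.2 • 1) (-f p.1)
  map_add' p q := by
    simp [Matrix.fromBlocks_add, add_smul, add_comm]
  map_smul' c p := by
    simp [Matrix.fromBlocks_smul, mul_smul]

theorem hyperbolicBlocks_mul_self {R V n : Type*} [CommRing R] [AddCommGroup V] [Module R V]
    [Fintype n] [DecidableEq n] (f : V →ₗ[R] Matrix n n R) (q : V → R)
    (hf : ∀ v, f v * f v = algebraMap R _ (q v)) (p : V × R × R) :
    hyperbolicBlocks f p * hyperbolicBlocks f p =
      algebraMap R _ (q p.1 + p.2.1 * p.2.2) := by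
  simp only [hyperbolicBlocks, LinearMap.coe_mk, AddHom.coe_mk, Matrix.fromBlocks_multiply,
    Algebra.algebraMap_eq_smul_one, ← Matrix.fromBlocks_one, Matrix.fromBlocks_smul] at hf ⊢
  congr 1 <;> simp [hf, add_smul, mul_smul, add_comm, smul_comm p.2.1 p.2.2]

theorem adjoin_range_hyperbolicBlocks {R V n : Type*} [CommRing R] [AddCommGroup V] [Module R V]
    [Fintype n] [DecidableEq n] (f : V →ₗ[R] Matrix n n R)
    (hf : Algebra.adjoin R (Set.range f) = ⊤) :
    Algebra.adjoin R (Set.range (hyperbolicBlocks f)) = ⊤ := by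
  set S := Algebra.adjoin R (Set.range (hyperbolicBlocks f)) with hS
  have hmem (p : V × R × R) : hyperbolicBlocks f p ∈ S := Algebra.subset_adjoin ⟨p, rfl⟩
  have h12 : Matrix.fromBlocks 0 1 0 0 ∈ S := by simpa [hyperbolicBlocks] using hmem (0, 1, 0)
  have h21 : Matrix.fromBlocks 0 0 1 0 ∈ S := by simpa [hyperbolicBlocks] using hmem (0, 0, 1)
  have h11 : Matrix.fromBlocks 1 0 0 0 ∈ S := by
    simpa [Matrix.fromBlocks_multiply] using mul_mem h12 h21
  have hdiag (a : Matrix n n R) : Matrix.fromBlocks a 0 0 0 ∈ S := by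
    have ha : a ∈ Algebra.adjoin R (Set.range f) := hf ▸ Algebra.mem_top
    induction ha using Algebra.adjoin_induction with
    | mem a ha =>
      obtain ⟨v, rfl⟩ := ha
      simpa [hyperbolicBlocks, Matrix.fromBlocks_multiply] using mul_mem h11 (hmem (v, 0, 0))
    | algebraMap r =>
      simpa [Matrix.fromBlocks_smul, Algebra.algebraMap_eq_smul_one] using S.smul_mem h11 r
    | add a b _ _ iha ihb => simpa [Matrix.fromBlocks_add] using add_mem iha ihb
    | mul a b _ _ iha ihb => simpa [Matrix.fromBlocks_multiply] using mul_mem iha ihb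
  refine eq_top_iff.2 fun x _ => ?_
  have hx := add_mem (add_mem (hdiag x.toBlocks₁₁) (mul_mem (hdiag x.toBlocks₁₂) h12))
    (add_mem (mul_mem h21 (hdiag x.toBlocks₂₁)) (mul_mem (mul_mem h21 (hdiag x.toBlocks₂₂)) h12))
  simpa [Matrix.fromBlocks_multiply, Matrix.fromBlocks_add, Matrix.fromBlocks_toBlocks] using hx

/-- The linear change of coordinates splitting `x₀² + x₁²` off a sum of squares over `ℂ` as the
hyperbolic form `(x₀ + i x₁) (x₀ - i x₁)`. -/
def splitHyperbolicPlane (k : ℕ) : (Fin (k + 2) → ℂ) →ₗ[ℂ] (Fin k → ℂ) × ℂ × ℂ where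
  toFun x := (fun i => x i.succ.succ, x 0 + Complex.I * x 1, x 0 - Complex.I * x 1)
  map_add' x y := by
    ext <;> simp <;> ring
  map_smul' c x := by
    ext <;> simp <;> ring

theorem splitHyperbolicPlane_surjective (k : ℕ) :
    Function.Surjective (splitHyperbolicPlane k) := by
  rintro ⟨v, s, t⟩
  refine ⟨Fin.cons ((s + t) / 2) (Fin.cons (-Complex.I * (s - t) / 2) v), ?_⟩
  have hI := Complex.I_mul_I
  simp only [splitHyperbolicPlane, LinearMap.coe_mk, AddHom.coe_mk, Fin.cons_succ, Fin.cons_zero,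
    Fin.cons_one, Prod.mk.injEq, true_and]
  constructor
  · linear_combination (-(s - t) / 2) * hI
  · linear_combination ((s - t) / 2) * hI

theorem sum_sq_eq_splitHyperbolicPlane (k : ℕ) (x : Fin (k + 2) → ℂ) :
    ∑ i, x i ^ 2 = ∑ i, (splitHyperbolicPlane k x).1 i ^ 2 +
      (splitHyperbolicPlane k x).2.1 * (splitHyperbolicPlane k x).2.2 := by
  simp only [splitHyperbolicPlane, LinearMap.coe_mk, AddHom.coe_mk, Fin.sum_univ_succ (n := k + 1),
    Fin.sum_univ_succ (n := k), Fin.succ_zero_eq_one]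
  linear_combination x 1 ^ 2 * Complex.I_mul_I

/-- The complex gamma matrices: a linear map to `2 ^ m × 2 ^ m` matrices squaring to the sum of
squares, whose image generates the full matrix algebra. -/
theorem exists_gammaMatrices (m : ℕ) :
    ∃ f : (Fin (2 * m) → ℂ) →ₗ[ℂ] Matrix (Fin (2 ^ m)) (Fin (2 ^ m)) ℂ,
      (∀ x, f x * f x = algebraMap ℂ _ (∑ i, x i ^ 2)) ∧
        Algebra.adjoin ℂ (Set.range f) = ⊤ := by
  induction m with
  | zero =>
    refine ⟨0, fun x => by simp, eq_top_iff.2 fun a _ => ?_⟩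
    have ha : a = algebraMap ℂ _ (a 0 0) := by
      ext i j
      fin_cases i
      fin_cases j
      simp [Matrix.algebraMap_matrix_apply]
    exact ha ▸ Subalgebra.algebraMap_mem _ _
  | succ m ih =>
    obtain ⟨f, hsq, htop⟩ := ih
    rw [Nat.mul_succ]
    let e : Fin (2 ^ m) ⊕ Fin (2 ^ m) ≃ Fin (2 ^ (m + 1)) :=
      finSumFinEquiv.trans (finCongr (by ring))
    let φ := Matrix.reindexAlgEquiv ℂ ℂ e
    let g := hyperbolicBlocks f ∘ₗ splitHyperbolicPlane (2 * m)
    have hrange : Set.range g = Set.range (hyperbolicBlocks f) :=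
      (splitHyperbolicPlane_surjective (2 * m)).range_comp (hyperbolicBlocks f)
    refine ⟨φ.toLinearMap ∘ₗ g, fun x => ?_, ?_⟩
    · have hg : g x * g x = algebraMap ℂ _ (∑ i, x i ^ 2) := by
        rw [sum_sq_eq_splitHyperbolicPlane (2 * m) x]
        exact hyperbolicBlocks_mul_self f (fun v => ∑ i, v i ^ 2) hsq _
      change φ (g x) * φ (g x) = _
      rw [← map_mul, hg, AlgEquiv.commutes]
    · have himage : Set.range (φ.toLinearMap ∘ₗ g) =
          (φ : _ →ₐ[ℂ] _) '' Set.range (hyperbolicBlocks f) := by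
        rw [← hrange, ← Set.range_comp]
        rfl
      rw [himage, ← AlgHom.map_adjoin, adjoin_range_hyperbolicBlocks f htop, Algebra.map_top,
        AlgHom.range_eq_top]
      exact φ.surjective

theorem finrank_cliffordAlgebra {K ι : Type*} [Field K] [Invertible (2 : K)]
    [Fintype ι] [LinearOrder ι] (Q : QuadraticForm K (ι → K)) :
    Module.finrank K (CliffordAlgebra Q) = 2 ^ Fintype.card ι := by
  rw [(CliffordAlgebra.equivExterior Q).finrank_eq,
    Module.finrank_eq_card_basis (Pi.basisFun K ι).ExteriorAlgebra, Fintype.card_finset]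

theorem clifford_even_iso_matrix (m : ℕ)
    (Q : QuadraticForm ℂ (Fin (2 * m) → ℂ))
    (hQ : ∀ x, Q x = ∑ i, (x i) ^ 2) :
    Nonempty (CliffordAlgebra Q ≃ₐ[ℂ] Matrix (Fin (2 ^ m)) (Fin (2 ^ m)) ℂ) := by
  obtain ⟨f, hsq, htop⟩ := exists_gammaMatrices m
  have hf (x : Fin (2 * m) → ℂ) : f x * f x = algebraMap ℂ _ (Q x) := by rw [hQ, hsq]
  let F := CliffordAlgebra.lift Q ⟨f, hf⟩
  have hsurj : Function.Surjective F := by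
    rw [← AlgHom.range_eq_top, CliffordAlgebra.range_lift, htop]
  have hrank : Module.finrank ℂ (CliffordAlgebra Q) = 2 ^ (2 * m) := by
    simpa using finrank_cliffordAlgebra Q
  have : FiniteDimensional ℂ (CliffordAlgebra Q) :=
    Module.finite_of_finrank_pos (by rw [hrank]; positivity)
  have hdim : Module.finrank ℂ (CliffordAlgebra Q) =
      Module.finrank ℂ (Matrix (Fin (2 ^ m)) (Fin (2 ^ m)) ℂ) := by
    rw [hrank, Module.finrank_matrix]
    simp only [Fintype.card_fin, Module.finrank_self]
    ring
  exact ⟨AlgEquiv.ofBijective F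
    ⟨(LinearMap.injective_iff_surjective_of_finrank_eq_finrank (f := F.toLinearMap) hdim).2 hsurj,
      hsurj⟩⟩
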